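/- arXiv:2108.03535 — 2 statements merged into one kernel-verified Lean document; each statement's English description precedes it below -/
import Mathlib

section
/- Let X ⊂ ℝ with the restriction metric and let n ≥ 2. The map A ↦ {max A} is a 1-Lipschitz retraction from X(n) onto X(1), and the map A ↦ {min A, max A} is a 1-Lipschitz retraction from X(n) onto X(2), where Lipschitz constants are with respect to the Hausdorff metric. -/
/-- `A` is a member of the finite subset space `Y(n)` of the subset `Y` of a metric
space: `A` is a nonempty subset of `Y` with at most `n` elements. -/
def MemFinSubsetSpace {X : Type*} (Y : Set X) (n : ℕ) (A : Set X) : Prop :=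
  A.Finite ∧ A.Nonempty ∧ A.ncard ≤ n ∧ A ⊆ Y

/-- Every point of a finite set is within the Hausdorff distance of some point of another
finite nonempty set. -/
theorem exists_dist_le_hausdorffDist {X : Type*} [PseudoMetricSpace X] {A B : Set X}
    (hA : A.Finite) (hB : B.Finite) (hB' : B.Nonempty) {a : X} (ha : a ∈ A) :
    ∃ b ∈ B, dist a b ≤ Metric.hausdorffDist A B := by
  obtain ⟨b, hb, hab⟩ := hB.isCompact.exists_infDist_eq_dist hB' a
  refine ⟨b, hb, hab ▸ Metric.infDist_le_hausdorffDist_of_mem ha ?_⟩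
  exact Metric.hausdorffEDist_ne_top_of_nonempty_of_bounded ⟨a, ha⟩ hB'
    hA.isBounded hB.isBounded

theorem csSup_le_csSup_add_hausdorffDist {A B : Set ℝ} (hA : A.Finite) (hA' : A.Nonempty)
    (hB : B.Finite) (hB' : B.Nonempty) :
    sSup A ≤ sSup B + Metric.hausdorffDist A B := by
  obtain ⟨b, hb, hab⟩ := exists_dist_le_hausdorffDist hA hB hB' (hA'.csSup_mem hA)
  rw [Real.dist_eq] at hab
  linarith [le_csSup hB.bddAbove hb, le_abs_self (sSup A - b)]

theorem csInf_le_csInf_add_hausdorffDist {A B : Set ℝ} (hA : A.Finite) (hA' : A.Nonempty)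
    (hB : B.Finite) (hB' : B.Nonempty) :
    sInf A ≤ sInf B + Metric.hausdorffDist A B := by
  obtain ⟨a, ha, hab⟩ := exists_dist_le_hausdorffDist hB hA hA' (hB'.csInf_mem hB)
  rw [Real.dist_eq, Metric.hausdorffDist_comm] at hab
  linarith [csInf_le hA.bddBelow ha, neg_abs_le (sInf B - a)]

theorem dist_csSup_le_hausdorffDist {A B : Set ℝ} (hA : A.Finite) (hA' : A.Nonempty)
    (hB : B.Finite) (hB' : B.Nonempty) :
    dist (sSup A) (sSup B) ≤ Metric.hausdorffDist A B := by
  have h := csSup_le_csSup_add_hausdorffDist hB hB' hA hA'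
  rw [Metric.hausdorffDist_comm] at h
  rw [Real.dist_eq, abs_le]
  constructor <;> linarith [csSup_le_csSup_add_hausdorffDist hA hA' hB hB']

theorem dist_csInf_le_hausdorffDist {A B : Set ℝ} (hA : A.Finite) (hA' : A.Nonempty)
    (hB : B.Finite) (hB' : B.Nonempty) :
    dist (sInf A) (sInf B) ≤ Metric.hausdorffDist A B := by
  have h := csInf_le_csInf_add_hausdorffDist hB hB' hA hA'
  rw [Metric.hausdorffDist_comm] at h
  rw [Real.dist_eq, abs_le]
  constructor <;> linarith [csInf_le_csInf_add_hausdorffDist hA hA' hB hB']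

theorem pair_csInf_csSup_eq_of_ncard_le_two {A : Set ℝ} (hA : A.Finite) (hA' : A.Nonempty)
    (hcard : A.ncard ≤ 2) : ({sInf A, sSup A} : Set ℝ) = A := by
  have hsub : ({sInf A, sSup A} : Set ℝ) ⊆ A :=
    Set.pair_subset (hA'.csInf_mem hA) (hA'.csSup_mem hA)
  by_cases h : sInf A = sSup A
  · refine hsub.antisymm fun a ha => Or.inl ?_
    exact le_antisymm (h ▸ le_csSup hA.bddAbove ha) (csInf_le hA.bddBelow ha)
  · exact Set.eq_of_subset_of_ncard_le hsub (by rwa [Set.ncard_pair h]) hA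

/-- For any `X ⊆ ℝ` and `n ≥ 2`: `A ↦ {max A}` is a `1`-Lipschitz retraction of `X(n)`
onto `X(1)`, and `A ↦ {min A, max A}` is a `1`-Lipschitz retraction of `X(n)` onto
`X(2)` (Lipschitz with respect to the Hausdorff metric). -/
theorem max_and_minmax_retractions (Y : Set ℝ) (n : ℕ) (hn : 2 ≤ n) :
    ((∀ A : Set ℝ, MemFinSubsetSpace Y n A → MemFinSubsetSpace Y 1 {sSup A}) ∧
      (∀ A : Set ℝ, MemFinSubsetSpace Y 1 A → {sSup A} = A) ∧
      (∀ A B : Set ℝ, MemFinSubsetSpace Y n A → MemFinSubsetSpace Y n B →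
        Metric.hausdorffDist ({sSup A} : Set ℝ) ({sSup B} : Set ℝ) ≤
          Metric.hausdorffDist A B)) ∧
    ((∀ A : Set ℝ, MemFinSubsetSpace Y n A → MemFinSubsetSpace Y 2 {sInf A, sSup A}) ∧
      (∀ A : Set ℝ, MemFinSubsetSpace Y 2 A → ({sInf A, sSup A} : Set ℝ) = A) ∧
      (∀ A B : Set ℝ, MemFinSubsetSpace Y n A → MemFinSubsetSpace Y n B →
        Metric.hausdorffDist ({sInf A, sSup A} : Set ℝ) ({sInf B, sSup B} : Set ℝ) ≤
          Metric.hausdorffDist A B)) := by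
  refine ⟨⟨?_, ?_, ?_⟩, ?_, ?_, ?_⟩
  · rintro A ⟨hA, hA', -, hAY⟩
    exact ⟨Set.finite_singleton _, Set.singleton_nonempty _, (Set.ncard_singleton _).le,
      Set.singleton_subset_iff.2 (hAY (hA'.csSup_mem hA))⟩
  · rintro A ⟨hA, hA', hcard, -⟩
    exact Set.eq_of_subset_of_ncard_le (Set.singleton_subset_iff.2 (hA'.csSup_mem hA))
      (by rwa [Set.ncard_singleton]) hA
  · rintro A B ⟨hA, hA', -, -⟩ ⟨hB, hB', -, -⟩
    rw [Metric.hausdorffDist_singleton]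
    exact dist_csSup_le_hausdorffDist hA hA' hB hB'
  · rintro A ⟨hA, hA', -, hAY⟩
    exact ⟨Set.toFinite _, Set.insert_nonempty _ _,
      (Set.ncard_insert_le _ _).trans (by rw [Set.ncard_singleton]),
      Set.pair_subset (hAY (hA'.csInf_mem hA)) (hAY (hA'.csSup_mem hA))⟩
  · rintro A ⟨hA, hA', hcard, -⟩
    exact pair_csInf_csSup_eq_of_ncard_le_two hA hA' hcard
  · rintro A B ⟨hA, hA', -, -⟩ ⟨hB, hB', -, -⟩
    have hInf := dist_csInf_le_hausdorffDist hA hA' hB hB'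
    have hSup := dist_csSup_le_hausdorffDist hA hA' hB hB'
    refine Metric.hausdorffDist_le_of_mem_dist Metric.hausdorffDist_nonneg ?_ ?_
    · rintro x (rfl | rfl)
      · exact ⟨_, Or.inl rfl, hInf⟩
      · exact ⟨_, Or.inr rfl, hSup⟩
    · rintro x (rfl | rfl)
      · exact ⟨_, Or.inl rfl, dist_comm (sInf A) _ ▸ hInf⟩
      · exact ⟨_, Or.inr rfl, dist_comm (sSup A) _ ▸ hSup⟩
end

section
/- Let X = ℝ × ℤ, considered as a subset of ℝ² with the Euclidean restriction metric. Then X does not have the Lipschitz Clustering Property; specifically, there exists no Lipschitz retraction from X(4) onto X(3). In particular, an additive subgroup of ℝ² need not have the Lipschitz Clustering Property. -/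
/-- `r` is a retraction from `Y(n)` onto `Y(m)` which is `L`-Lipschitz with respect to
the Hausdorff metric. -/
def IsLipschitzRetraction {X : Type*} [MetricSpace X] (Y : Set X) (n m : ℕ) (L : ℝ)
    (r : Set X → Set X) : Prop :=
  (∀ A, MemFinSubsetSpace Y n A → MemFinSubsetSpace Y m (r A)) ∧
  (∀ A, MemFinSubsetSpace Y m A → r A = A) ∧
  (∀ A B, MemFinSubsetSpace Y n A → MemFinSubsetSpace Y n B →
    Metric.hausdorffDist (r A) (r B) ≤ L * Metric.hausdorffDist A B)

/-- The subset `Y ⊆ X` has the Lipschitz Clustering Property: for every `n ≥ 2` there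
is a Lipschitz retraction from `Y(n)` onto `Y(n-1)`. -/
def HasLCP {X : Type*} [MetricSpace X] (Y : Set X) : Prop :=
  ∀ n : ℕ, 2 ≤ n → ∃ (L : ℝ) (r : Set X → Set X), IsLipschitzRetraction Y n (n - 1) L r

/-- The set `ℝ × ℤ` viewed as a subset of the Euclidean plane. -/
def realCrossInt : Set (EuclideanSpace ℝ (Fin 2)) := {p | ∃ k : ℤ, p 1 = (k : ℝ)}

open Metric Set

/-- The Euclidean plane. -/
abbrev EuclideanPlane := EuclideanSpace ℝ (Fin 2)

lemma abs_sub_coord_le_dist (p q : EuclideanPlane) (i : Fin 2) : |p i - q i| ≤ dist p q := by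
  simpa [dist_eq_norm] using PiLp.norm_apply_le (p - q) i

lemma dist_same_height (x y k : ℝ) : dist (!₂[x, k] : EuclideanPlane) !₂[y, k] = |x - y| := by
  simp [EuclideanSpace.dist_eq, Fin.sum_univ_two, Real.dist_eq, Real.sqrt_sq_eq_abs]

lemma dist_same_abscissa (x k l : ℝ) : dist (!₂[x, k] : EuclideanPlane) !₂[x, l] = |k - l| := by
  simp [EuclideanSpace.dist_eq, Fin.sum_univ_two, Real.dist_eq, Real.sqrt_sq_eq_abs]

lemma mk_mem_realCrossInt (x : ℝ) (k : ℤ) : (!₂[x, (k : ℝ)] : EuclideanPlane) ∈ realCrossInt :=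
  ⟨k, by simp⟩

lemma realCrossInt_height_eq_of_dist_lt_one {p q : EuclideanPlane} (hp : p ∈ realCrossInt)
    (hq : q ∈ realCrossInt) (h : dist p q < 1) : p 1 = q 1 := by
  obtain ⟨k, hk⟩ := hp
  obtain ⟨l, hl⟩ := hq
  have h1 : |(k : ℝ) - l| < 1 := by
    rw [← hk, ← hl]
    exact (abs_sub_coord_le_dist p q 1).trans_lt h
  have h2 : |k - l| < 1 := by exact_mod_cast h1
  rw [hk, hl, sub_eq_zero.mp (Int.abs_lt_one_iff.mp h2)]

lemma MemFinSubsetSpace.mono {X : Type*} {Y : Set X} {m n : ℕ} {A : Set X} (hmn : m ≤ n)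
    (hA : MemFinSubsetSpace Y m A) : MemFinSubsetSpace Y n A :=
  ⟨hA.1, hA.2.1, hA.2.2.1.trans hmn, hA.2.2.2⟩

lemma MemFinSubsetSpace.hausdorffEDist_ne_top {X : Type*} [MetricSpace X] {Y : Set X} {m n : ℕ}
    {A B : Set X} (hA : MemFinSubsetSpace Y m A) (hB : MemFinSubsetSpace Y n B) :
    hausdorffEDist A B ≠ ⊤ :=
  hausdorffEDist_ne_top_of_nonempty_of_bounded hA.2.1 hB.2.1 hA.1.isBounded hB.1.isBounded

lemma memFinSubsetSpace_triple {X : Type*} {Y : Set X} {a b c : X} (ha : a ∈ Y) (hb : b ∈ Y)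
    (hc : c ∈ Y) : MemFinSubsetSpace Y 3 {a, b, c} := by
  refine ⟨by simp, by simp, ?_, by simp [insert_subset_iff, ha, hb, hc]⟩
  have h1 := ncard_insert_le a {b, c}
  have h2 := ncard_insert_le b {c}
  rw [ncard_singleton] at h2
  omega

lemma memFinSubsetSpace_insert {X : Type*} {Y : Set X} {n : ℕ} {a : X} {A : Set X} (ha : a ∈ Y)
    (hA : MemFinSubsetSpace Y n A) : MemFinSubsetSpace Y (n + 1) (insert a A) := by
  refine ⟨hA.1.insert a, by simp, ?_, insert_subset ha hA.2.2.2⟩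
  have := ncard_insert_le a A
  have := hA.2.2.1
  omega

lemma hausdorffDist_insert_self_le {X : Type*} [MetricSpace X] {A : Set X} {a b : X} (hb : b ∈ A) :
    hausdorffDist A (insert a A) ≤ dist a b := by
  refine hausdorffDist_le_of_mem_dist dist_nonneg (fun x hx => ⟨x, by simp [hx], by simp⟩) ?_
  rintro x (rfl | hx)
  · exact ⟨b, hb, le_rfl⟩
  · exact ⟨x, hx, by simp⟩

lemma hausdorffDist_insert_insert_le {X : Type*} [MetricSpace X] (A : Set X) (a b : X) :
    hausdorffDist (insert a A) (insert b A) ≤ dist a b := by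
  refine hausdorffDist_le_of_mem_dist dist_nonneg ?_ ?_
  · rintro x (rfl | hx)
    · exact ⟨b, by simp, le_rfl⟩
    · exact ⟨x, by simp [hx], by simp⟩
  · rintro x (rfl | hx)
    · exact ⟨a, by simp, (dist_comm _ _).le⟩
    · exact ⟨x, by simp [hx], by simp⟩

/-- A Lipschitz retraction moves `A ∪ {a}` by an amount controlled by the distance from `a`
to `A`. -/
lemma IsLipschitzRetraction.hausdorffDist_insert_le {X : Type*} [MetricSpace X] {Y : Set X}
    {m : ℕ} {L : ℝ} {r : Set X → Set X} (hr : IsLipschitzRetraction Y (m + 1) m L r) (hL : 0 ≤ L)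
    {A : Set X} {a b : X} (hA : MemFinSubsetSpace Y m A) (ha : a ∈ Y) (hb : b ∈ A) :
    hausdorffDist (r (insert a A)) (insert a A) ≤ (L + 1) * dist a b := by
  have hA' := memFinSubsetSpace_insert ha hA
  have h1 := hausdorffDist_insert_self_le (a := a) hb
  have h2 := hr.2.2 _ _ hA' (hA.mono m.le_succ)
  rw [hr.2.1 A hA, hausdorffDist_comm (s := insert a A)] at h2
  have h3 := hausdorffDist_triangle (u := insert a A) ((hr.1 _ hA').hausdorffEDist_ne_top hA)
  nlinarith [mul_le_mul_of_nonneg_left h1 hL]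

/-- A property of points of an interval that propagates along short steps propagates from the
right endpoint to the left one. -/
lemma Icc_step_induction {Q : ℝ → Prop} {u v δ : ℝ} (hδ : 0 < δ) (huv : u ≤ v)
    (step : ∀ s ∈ Icc u v, ∀ t ∈ Icc u v, |s - t| ≤ δ → Q s → Q t) (hv : Q v) : Q u := by
  have key : ∀ n : ℕ, Q (max u (v - n * δ)) := by
    intro n
    induction n with
    | zero => simpa [huv] using hv
    | succ n ih =>
      have hn : 0 ≤ (n : ℝ) * δ := by positivity
      refine step _ ⟨le_max_left _ _, max_le huv (by linarith)⟩ _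
        ⟨le_max_left _ _, max_le huv (by push_cast; linarith)⟩ ?_ ih
      refine (abs_max_sub_max_le_max _ _ _ _).trans ?_
      push_cast
      rw [show v - n * δ - (v - (n + 1) * δ) = δ by ring]
      simp [abs_of_pos hδ, hδ.le]
  obtain ⟨n, hn⟩ := exists_nat_ge ((v - u) / δ)
  rw [div_le_iff₀ hδ] at hn
  simpa [max_eq_left (show v - n * δ ≤ u by linarith)] using key n

/-- The vertices of the rectangle with abscissae `b`, `b + ε S` and heights `k`, `l`, where the
vertex `(b, k)` has been moved to `(b + ε t, k)`. -/
def slidingRectangle (b ε S k l t : ℝ) : Set EuclideanPlane :=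
  {!₂[b + ε * t, k], !₂[b + ε * S, k], !₂[b + ε * S, l], !₂[b, l]}

lemma memFinSubsetSpace_slidingRectangle (b ε S t : ℝ) (k l : ℤ) :
    MemFinSubsetSpace realCrossInt 4 (slidingRectangle b ε S k l t) :=
  memFinSubsetSpace_insert (mk_mem_realCrossInt _ _) (memFinSubsetSpace_triple
    (mk_mem_realCrossInt _ _) (mk_mem_realCrossInt _ _) (mk_mem_realCrossInt _ _))

section

variable {L : ℝ} {r : Set EuclideanPlane → Set EuclideanPlane}

lemma slidingRectangle_retract_near (hr : IsLipschitzRetraction realCrossInt 4 3 L r)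
    (hL : 0 ≤ L) {b ε S t : ℝ} {k l : ℤ} (hε : |ε| = 1) (hkl : |(k : ℝ) - l| = 1)
    (hS : 0 ≤ S) (ht : 0 ≤ t) {p : EuclideanPlane} (hp : p ∈ r (slidingRectangle b ε S k l t)) :
    |(|p 0 - b|) - t| < L + 2 ∨ |(|p 0 - b|) - S| < L + 2 ∨ |p 0 - b| < L + 2 := by
  have hF := memFinSubsetSpace_slidingRectangle b ε S t k l
  have heq : slidingRectangle b ε S k l t = insert (!₂[b + ε * S, (k : ℝ)] : EuclideanPlane)
      {!₂[b + ε * t, (k : ℝ)], !₂[b + ε * S, (l : ℝ)], !₂[b, (l : ℝ)]} := insert_comm _ _ _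
  have h := hr.hausdorffDist_insert_le hL (a := !₂[b + ε * S, (k : ℝ)])
    (b := !₂[b + ε * S, (l : ℝ)])
    (memFinSubsetSpace_triple (mk_mem_realCrossInt (b + ε * t) k)
      (mk_mem_realCrossInt (b + ε * S) l) (mk_mem_realCrossInt b l))
    (mk_mem_realCrossInt _ _) (by simp)
  rw [← heq, dist_same_abscissa, hkl] at h
  obtain ⟨q, hq, hpq⟩ := exists_dist_lt_of_hausdorffDist_lt hp
    (show _ < L + 2 by linarith) ((hr.1 _ hF).hausdorffEDist_ne_top hF)
  have hx := (abs_sub_coord_le_dist p q 0).trans_lt hpq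
  have aux : ∀ s : ℝ, 0 ≤ s → q 0 = b + ε * s → |(|p 0 - b|) - s| < L + 2 := by
    intro s hs hqs
    have h1 : |ε * s| = s := by rw [abs_mul, hε, one_mul, abs_of_nonneg hs]
    have h2 := abs_abs_sub_abs_le (p 0 - b) (ε * s)
    rw [h1, show p 0 - b - ε * s = p 0 - q 0 by rw [hqs]; ring] at h2
    exact h2.trans_lt hx
  rcases hq with rfl | rfl | rfl | rfl
  · exact Or.inl (aux t ht (by simp))
  · exact Or.inr (Or.inl (aux S hS (by simp)))
  · exact Or.inr (Or.inl (aux S hS (by simp)))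
  · exact Or.inr (Or.inr (by simpa using hx))

/-- The image of the sliding rectangle keeps a point at height `l` within distance `θ` of `b` as
long as the images have a gap around abscissae at distance `θ` from `b`. -/
lemma slidingRectangle_transport (hr : IsLipschitzRetraction realCrossInt 4 3 L r)
    (hL : 0 ≤ L) {b ε S u v θ : ℝ} {k l : ℤ} (hε : |ε| = 1) (huv : u ≤ v)
    (gap : ∀ t ∈ Icc u v, ∀ p ∈ r (slidingRectangle b ε S k l t),
      |p 0 - b| < θ ∨ θ + 1 < |p 0 - b|)
    (hv : ∃ p ∈ r (slidingRectangle b ε S k l v), p 1 = l ∧ |p 0 - b| < θ) :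
    ∃ p ∈ r (slidingRectangle b ε S k l u), p 1 = l ∧ |p 0 - b| < θ := by
  refine Icc_step_induction (Q := fun t => ∃ p ∈ r (slidingRectangle b ε S k l t),
    p 1 = l ∧ |p 0 - b| < θ) (δ := 1 / (L + 1)) (by positivity) huv ?_ hv
  rintro s - t ht hst ⟨p, hp, hpl, hpb⟩
  have hs' := memFinSubsetSpace_slidingRectangle b ε S s k l
  have ht' := memFinSubsetSpace_slidingRectangle b ε S t k l
  have h1 : hausdorffDist (slidingRectangle b ε S k l s) (slidingRectangle b ε S k l t) ≤
      1 / (L + 1) := by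
    refine (hausdorffDist_insert_insert_le _ _ _).trans ?_
    rw [dist_same_height, add_sub_add_left_eq_sub, ← mul_sub, abs_mul, hε, one_mul]
    exact hst
  have h2 := (hr.2.2 _ _ hs' ht').trans (mul_le_mul_of_nonneg_left h1 hL)
  have h3 : L * (1 / (L + 1)) < 1 := by
    rw [mul_one_div, div_lt_one (by positivity)]
    linarith
  obtain ⟨q, hq, hpq⟩ := exists_dist_lt_of_hausdorffDist_lt hp (h2.trans_lt h3)
    ((hr.1 _ hs').hausdorffEDist_ne_top (hr.1 _ ht'))
  refine ⟨q, hq, ?_, ?_⟩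
  · rw [← hpl]
    exact (realCrossInt_height_eq_of_dist_lt_one ((hr.1 _ hs').2.2.2 hp)
      ((hr.1 _ ht').2.2.2 hq) hpq).symm
  · have h4 := (abs_sub_coord_le_dist p q 0).trans_lt hpq
    have h5 := abs_sub_abs_le_abs_sub (q 0 - b) (p 0 - b)
    rw [sub_sub_sub_cancel_right, abs_sub_comm (q 0) (p 0)] at h5
    rcases gap t ht q hq with h | h
    · exact h
    · linarith

/-- The image of a long rectangle of height one has a point near each of its vertices, on the
same height. -/
lemma exists_mem_retract_rectangle_near_vertex
    (hr : IsLipschitzRetraction realCrossInt 4 3 L r) (hL : 0 ≤ L) {b ε S : ℝ} {k l : ℤ}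
    (hε : |ε| = 1) (hkl : |(k : ℝ) - l| = 1) (hS : S = 100 * (L + 2)) :
    ∃ p ∈ r (slidingRectangle b ε S k l 0), p 1 = l ∧ |p 0 - b| < 40 * (L + 2) := by
  have hstart : ∃ p ∈ r (slidingRectangle b ε S k l S), p 1 = l ∧ |p 0 - b| < 12 * (L + 2) := by
    have h3 := memFinSubsetSpace_triple (mk_mem_realCrossInt (b + ε * S) k)
      (mk_mem_realCrossInt (b + ε * S) l) (mk_mem_realCrossInt b l)
    refine ⟨!₂[b, (l : ℝ)], ?_, by simp, ?_⟩
    · rw [slidingRectangle, insert_eq_of_mem (by simp), hr.2.1 _ h3]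
      simp
    · simp
      linarith
  have hmid := slidingRectangle_transport hr hL hε (u := 25 * (L + 2)) (by linarith)
    (fun t ht p hp => by
      have ht1 := ht.1
      have hn := slidingRectangle_retract_near hr hL hε hkl (by linarith) (by linarith) hp
      simp only [abs_lt (a := _ - t), abs_lt (a := _ - S)] at hn
      rcases hn with h | h | h
      · exact Or.inr (by linarith)
      · exact Or.inr (by linarith)
      · exact Or.inl (by linarith)) hstart
  obtain ⟨p, hp, hpl, hpb⟩ := hmid
  exact slidingRectangle_transport hr hL hε (by linarith)
    (fun t ht p hp => by
      have ht2 := ht.2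
      have hn := slidingRectangle_retract_near hr hL hε hkl (by linarith) ht.1 hp
      simp only [abs_lt (a := _ - t), abs_lt (a := _ - S)] at hn
      rcases hn with h | h | h
      · exact Or.inl (by linarith)
      · exact Or.inr (by linarith)
      · exact Or.inl (by linarith)) ⟨p, hp, hpl, by linarith⟩

end

lemma not_isLipschitzRetraction_realCrossInt_four_three (L : ℝ) (r : Set EuclideanPlane → Set EuclideanPlane) :
    ¬ IsLipschitzRetraction realCrossInt 4 3 L r := by
  intro hr₀
  have hL : 0 ≤ max L 0 := le_max_right _ _
  have hr : IsLipschitzRetraction realCrossInt 4 3 (max L 0) r :=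
    ⟨hr₀.1, hr₀.2.1, fun A B hA hB => (hr₀.2.2 A B hA hB).trans
      (mul_le_mul_of_nonneg_right (le_max_left _ _) hausdorffDist_nonneg)⟩
  generalize max L 0 = K at hL hr
  obtain ⟨S, hS⟩ : ∃ S, S = 100 * (K + 2) := ⟨_, rfl⟩
  obtain ⟨p₁, h₁, l₁, x₁⟩ := exists_mem_retract_rectangle_near_vertex hr hL (b := 0) (ε := 1)
    (k := 0) (l := 1) (by simp) (by simp) hS
  obtain ⟨p₂, h₂, l₂, x₂⟩ := exists_mem_retract_rectangle_near_vertex hr hL (b := 0) (ε := 1)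
    (k := 1) (l := 0) (by simp) (by simp) hS
  obtain ⟨p₃, h₃, l₃, x₃⟩ := exists_mem_retract_rectangle_near_vertex hr hL (b := S) (ε := -1)
    (k := 0) (l := 1) (by simp) (by simp) hS
  obtain ⟨p₄, h₄, l₄, x₄⟩ := exists_mem_retract_rectangle_near_vertex hr hL (b := S) (ε := -1)
    (k := 1) (l := 0) (by simp) (by simp) hS
  have e₂ : slidingRectangle 0 1 S (1 : ℤ) (0 : ℤ) 0 =
      slidingRectangle 0 1 S (0 : ℤ) (1 : ℤ) 0 := by
    ext p; simp [slidingRectangle]; tauto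
  have e₃ : slidingRectangle S (-1) S (0 : ℤ) (1 : ℤ) 0 =
      slidingRectangle 0 1 S (0 : ℤ) (1 : ℤ) 0 := by
    ext p; simp [slidingRectangle]; tauto
  have e₄ : slidingRectangle S (-1) S (1 : ℤ) (0 : ℤ) 0 =
      slidingRectangle 0 1 S (0 : ℤ) (1 : ℤ) 0 := by
    ext p; simp [slidingRectangle]; tauto
  rw [e₂] at h₂
  rw [e₃] at h₃
  rw [e₄] at h₄
  have hA := hr.1 _ (memFinSubsetSpace_slidingRectangle 0 1 S 0 0 1)
  rw [abs_lt] at x₁ x₂ x₃ x₄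
  push_cast at l₁ l₂ l₃ l₄
  have n₁₂ : p₁ ≠ p₂ := by rintro rfl; linarith
  have n₁₃ : p₁ ≠ p₃ := by rintro rfl; linarith
  have n₁₄ : p₁ ≠ p₄ := by rintro rfl; linarith
  have n₂₃ : p₂ ≠ p₃ := by rintro rfl; linarith
  have n₂₄ : p₂ ≠ p₄ := by rintro rfl; linarith
  have n₃₄ : p₃ ≠ p₄ := by rintro rfl; linarith
  have hsub : ({p₁, p₂, p₃, p₄} : Set EuclideanPlane) ⊆ r (slidingRectangle 0 1 S (0 : ℤ) (1 : ℤ) 0) := by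
    simp [insert_subset_iff, -Int.cast_zero, -Int.cast_one, h₁, h₂, h₃, h₄]
  have hle := (ncard_le_ncard hsub hA.1).trans hA.2.2.1
  rw [ncard_insert_of_notMem (by simp [n₁₂, n₁₃, n₁₄]),
    ncard_insert_of_notMem (by simp [n₂₃, n₂₄]), ncard_pair n₃₄] at hle
  omega

/-- `ℝ × ℤ` as an additive subgroup of the Euclidean plane. -/
def realCrossIntAddSubgroup : AddSubgroup EuclideanPlane where
  carrier := realCrossInt
  add_mem' := by
    rintro p q ⟨k, hk⟩ ⟨l, hl⟩
    exact ⟨k + l, by simp [hk, hl]⟩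
  zero_mem' := ⟨0, by simp⟩
  neg_mem' := by
    rintro p ⟨k, hk⟩
    exact ⟨-k, by simp [hk]⟩

/-- Example 5.6: the set `X = ℝ × ℤ ⊆ ℝ²`, with the Euclidean restriction metric, does
not have the Lipschitz Clustering Property; in fact there is no Lipschitz retraction
from `X(4)` onto `X(3)`. In particular, since `X` is an additive subgroup of `ℝ²`,
additive subgroups of `ℝ²` need not have the Lipschitz Clustering Property. -/
theorem realCrossInt_no_LCP :
    (¬ ∃ (L : ℝ) (r : Set (EuclideanSpace ℝ (Fin 2)) → Set (EuclideanSpace ℝ (Fin 2))),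
      IsLipschitzRetraction realCrossInt 4 3 L r) ∧
    ¬ HasLCP realCrossInt ∧
    (∃ G : AddSubgroup (EuclideanSpace ℝ (Fin 2)), (G : Set (EuclideanSpace ℝ (Fin 2))) = realCrossInt) := by
  refine ⟨?_, ?_, realCrossIntAddSubgroup, rfl⟩
  · rintro ⟨L, r, hr⟩
    exact not_isLipschitzRetraction_realCrossInt_four_three L r hr
  · intro h
    obtain ⟨L, r, hr⟩ := h 4 (by norm_num)
    exact not_isLipschitzRetraction_realCrossInt_four_three L r hr
end
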